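/- Let J : ℝⁿ → [0,∞] satisfy (T J)(x) ≤ J(x) for all x (i.e., J belongs to the region of decreasing), let ℓ be a positive integer, and let μ̃ be a policy satisfying (T_{μ̃}(T^{ℓ−1} J))(x) = (T^ℓ J)(x) for all x ∈ ℝⁿ. Let μ* be a policy whose cost function J* = J_{μ*} satisfies the Bellman equation (T_{μ*} J*)(x) = J*(x) for all x (a stationary optimal policy), and let Ĵ : ℝⁿ → [0,∞] satisfy Ĵ(x) ≤ J*(x) for all x. Then for every x ∈ ℝⁿ, J_{μ̃}(x) + (T_{μ*}^ℓ Ĵ)(x) ≤ J*(x) + (T_{μ*}^ℓ J)(x) (the extended-nonnegative-real form of J_{μ̃} − J* ≤ T_{μ*}^ℓ J − T_{μ*}^ℓ Ĵ). -/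

import Mathlib

open Matrix ENNReal

/-- The stage cost g(x,u) = xᵀQx + uᵀRu if x ∈ X̂, and g(x,u) = ∞ otherwise,
valued in the extended nonnegative reals. -/
noncomputable def stageCost {n m : ℕ} (Q : Matrix (Fin n) (Fin n) ℝ)
    (R : Matrix (Fin m) (Fin m) ℝ) (Xhat : Set (Fin n → ℝ))
    (x : Fin n → ℝ) (u : Fin m → ℝ) : ℝ≥0∞ := by
  classical exact
    if x ∈ Xhat then ENNReal.ofReal (x ⬝ᵥ Q.mulVec x + u ⬝ᵥ R.mulVec u) else ⊤

/-- The closed-loop trajectory x_{k+1} = A x_k + B μ(x_k) starting from x₀. -/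
noncomputable def traj {n m : ℕ} (A : Matrix (Fin n) (Fin n) ℝ)
    (B : Matrix (Fin n) (Fin m) ℝ) (μ : (Fin n → ℝ) → (Fin m → ℝ))
    (x0 : Fin n → ℝ) : ℕ → (Fin n → ℝ)
  | 0 => x0
  | k + 1 => A.mulVec (traj A B μ x0 k) + B.mulVec (μ (traj A B μ x0 k))

/-- The cost J_μ(x₀) = Σ_{k=0}^∞ g(x_k, μ(x_k)) of a stationary policy μ. -/
noncomputable def polCost {n m : ℕ} (A : Matrix (Fin n) (Fin n) ℝ)
    (B : Matrix (Fin n) (Fin m) ℝ) (Q : Matrix (Fin n) (Fin n) ℝ)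
    (R : Matrix (Fin m) (Fin m) ℝ) (Xhat : Set (Fin n → ℝ))
    (μ : (Fin n → ℝ) → (Fin m → ℝ)) (x0 : Fin n → ℝ) : ℝ≥0∞ :=
  ∑' k : ℕ, stageCost Q R Xhat (traj A B μ x0 k) (μ (traj A B μ x0 k))

/-- The Bellman operator (T J)(x) = inf_{u ∈ U} { g(x,u) + J(Ax + Bu) }. -/
noncomputable def Tbell {n m : ℕ} (A : Matrix (Fin n) (Fin n) ℝ)
    (B : Matrix (Fin n) (Fin m) ℝ) (Q : Matrix (Fin n) (Fin n) ℝ)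
    (R : Matrix (Fin m) (Fin m) ℝ) (Xhat : Set (Fin n → ℝ)) (U : Set (Fin m → ℝ))
    (J : (Fin n → ℝ) → ℝ≥0∞) (x : Fin n → ℝ) : ℝ≥0∞ :=
  ⨅ u ∈ U, stageCost Q R Xhat x u + J (A.mulVec x + B.mulVec u)

/-- The policy operator (T_μ J)(x) = g(x, μ(x)) + J(Ax + B μ(x)). -/
noncomputable def Tmu {n m : ℕ} (A : Matrix (Fin n) (Fin n) ℝ)
    (B : Matrix (Fin n) (Fin m) ℝ) (Q : Matrix (Fin n) (Fin n) ℝ)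
    (R : Matrix (Fin m) (Fin m) ℝ) (Xhat : Set (Fin n → ℝ))
    (μ : (Fin n → ℝ) → (Fin m → ℝ)) (J : (Fin n → ℝ) → ℝ≥0∞)
    (x : Fin n → ℝ) : ℝ≥0∞ :=
  stageCost Q R Xhat x (μ x) + J (A.mulVec x + B.mulVec (μ x))

theorem Tmu_monotone {n m : ℕ} (A : Matrix (Fin n) (Fin n) ℝ)
    (B : Matrix (Fin n) (Fin m) ℝ) (Q : Matrix (Fin n) (Fin n) ℝ)
    (R : Matrix (Fin m) (Fin m) ℝ) (Xhat : Set (Fin n → ℝ))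
    (μ : (Fin n → ℝ) → (Fin m → ℝ)) : Monotone (Tmu A B Q R Xhat μ) :=
  fun _ _ h _ => add_le_add_right (h _) _

theorem Tbell_monotone {n m : ℕ} (A : Matrix (Fin n) (Fin n) ℝ)
    (B : Matrix (Fin n) (Fin m) ℝ) (Q : Matrix (Fin n) (Fin n) ℝ)
    (R : Matrix (Fin m) (Fin m) ℝ) (Xhat : Set (Fin n → ℝ))
    (U : Set (Fin m → ℝ)) : Monotone (Tbell A B Q R Xhat U) :=
  fun _ _ h _ => iInf₂_mono fun _ _ => add_le_add_right (h _) _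

theorem Tbell_le_Tmu {n m : ℕ} (A : Matrix (Fin n) (Fin n) ℝ)
    (B : Matrix (Fin n) (Fin m) ℝ) (Q : Matrix (Fin n) (Fin n) ℝ)
    (R : Matrix (Fin m) (Fin m) ℝ) (Xhat : Set (Fin n → ℝ))
    {U : Set (Fin m → ℝ)} {μ : (Fin n → ℝ) → (Fin m → ℝ)} (hμ : ∀ x, μ x ∈ U) :
    Tbell A B Q R Xhat U ≤ Tmu A B Q R Xhat μ :=
  fun _ x => iInf₂_le (μ x) (hμ x)

/-- The cost of a policy is bounded by every function that its policy operator decreases. -/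
theorem polCost_le_of_Tmu_le {n m : ℕ} (A : Matrix (Fin n) (Fin n) ℝ)
    (B : Matrix (Fin n) (Fin m) ℝ) (Q : Matrix (Fin n) (Fin n) ℝ)
    (R : Matrix (Fin m) (Fin m) ℝ) (Xhat : Set (Fin n → ℝ))
    (μ : (Fin n → ℝ) → (Fin m → ℝ)) {V : (Fin n → ℝ) → ℝ≥0∞}
    (hV : Tmu A B Q R Xhat μ V ≤ V) : polCost A B Q R Xhat μ ≤ V := by
  intro x
  have key (N : ℕ) : ∑ k ∈ Finset.range N,
      stageCost Q R Xhat (traj A B μ x k) (μ (traj A B μ x k)) + V (traj A B μ x N) ≤ V x := by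
    induction N with
    | zero => simp [traj]
    | succ N ih =>
      rw [Finset.sum_range_succ, add_assoc]
      exact (add_le_add_right (hV (traj A B μ x N)) _).trans ih
  exact ENNReal.tsum_le_of_sum_range_le fun N => le_self_add.trans (key N)

/-- refined performance bound for the MPC policy μ̃ against a
stationary optimal policy μ*: J_{μ̃} + T_{μ*}^ℓ Ĵ ≤ J* + T_{μ*}^ℓ J pointwise
(the extended-nonnegative-real form of J_{μ̃} − J* ≤ T_{μ*}^ℓ J − T_{μ*}^ℓ Ĵ). -/
theorem mpc_policy_performance_bound_optimal {n m : ℕ} (hn : 0 < n) (hm : 0 < m)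
    (A : Matrix (Fin n) (Fin n) ℝ) (B : Matrix (Fin n) (Fin m) ℝ)
    (Q : Matrix (Fin n) (Fin n) ℝ) (R : Matrix (Fin m) (Fin m) ℝ)
    (hQ : Q.PosSemidef) (hR : R.PosDef)
    (Xhat : Set (Fin n → ℝ)) (U : Set (Fin m → ℝ)) (hU : U.Nonempty)
    (J : (Fin n → ℝ) → ℝ≥0∞)
    (hJ : ∀ x, Tbell A B Q R Xhat U J x ≤ J x)
    (ℓ : ℕ) (hℓ : 1 ≤ ℓ)
    (μtil : (Fin n → ℝ) → (Fin m → ℝ)) (hμtil : ∀ x, μtil x ∈ U)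
    (hdef : ∀ x, Tmu A B Q R Xhat μtil ((Tbell A B Q R Xhat U)^[ℓ - 1] J) x =
      (Tbell A B Q R Xhat U)^[ℓ] J x)
    (μstar : (Fin n → ℝ) → (Fin m → ℝ)) (hμstar : ∀ x, μstar x ∈ U)
    (hbell : ∀ x, Tmu A B Q R Xhat μstar (polCost A B Q R Xhat μstar) x =
      polCost A B Q R Xhat μstar x)
    (Jhat : (Fin n → ℝ) → ℝ≥0∞)
    (hJhat : ∀ x, Jhat x ≤ polCost A B Q R Xhat μstar x) :
    ∀ x, polCost A B Q R Xhat μtil x + (Tmu A B Q R Xhat μstar)^[ℓ] Jhat x ≤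
      polCost A B Q R Xhat μstar x + (Tmu A B Q R Xhat μstar)^[ℓ] J x := by
  set T := Tbell A B Q R Xhat U
  have hmono : Monotone T := Tbell_monotone A B Q R Xhat U
  have hdef' : Tmu A B Q R Xhat μtil (T^[ℓ - 1] J) = T^[ℓ] J := funext hdef
  have hdecr : T^[ℓ] J ≤ T^[ℓ - 1] J :=
    hmono.antitone_iterate_of_map_le hJ (Nat.sub_le ℓ 1)
  have htil : polCost A B Q R Xhat μtil ≤ T^[ℓ] J :=
    polCost_le_of_Tmu_le A B Q R Xhat μtil
      ((Tmu_monotone A B Q R Xhat μtil hdecr).trans_eq hdef')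
  have hstar : T^[ℓ] J ≤ (Tmu A B Q R Xhat μstar)^[ℓ] J :=
    hmono.iterate_le_of_le (Tbell_le_Tmu A B Q R Xhat hμstar) ℓ J
  have hhat : (Tmu A B Q R Xhat μstar)^[ℓ] Jhat ≤ polCost A B Q R Xhat μstar :=
    ((Tmu_monotone A B Q R Xhat μstar).iterate ℓ hJhat).trans_eq
      (Function.iterate_fixed (funext hbell) ℓ)
  intro x
  rw [add_comm (polCost A B Q R Xhat μstar x)]
  exact add_le_add ((htil.trans hstar) x) (hhat x)
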